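/- arXiv:math/9807098 — 2 statements merged into one kernel-verified Lean document; each statement's English description precedes it below -/
import Mathlib

section
/- Let A : [0,1] → (d×d real matrices) be C¹ and let Z : [0,1] → (d×d real matrices) be the solution of Z''(s) = A(s)Z(s) with Z(0) = 0 and Z'(0) = I. Let K > 0 and K₁ > 0 be constants with sup_{s∈[0,1]} |A(s)| ≤ K and sup_{s∈[0,1]} |A'(s)| ≤ K₁ (operator norms). Then Z(s) = s·I + (s³/6)·A(0) + s·𝓔(s), where the remainder satisfies |𝓔(s)| ≤ (1/6)·(2K₁s³ + (1/2)K²s⁴)·cosh(√K·s) for all s ∈ [0,1]. -/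
open Set Real

noncomputable section

lemma aux_integrate {F : Type*} [NormedAddCommGroup F] [NormedSpace ℝ F]
    (f f' : ℝ → F) (B B' : ℝ → ℝ) (T : ℝ) (hT : T ∈ Icc (0:ℝ) 1)
    (hf : ∀ s ∈ Icc (0:ℝ) 1, HasDerivWithinAt f (f' s) (Icc 0 1) s)
    (h0 : f 0 = 0) (hB0 : B 0 = 0) (hB : ∀ s, HasDerivAt B (B' s) s)
    (hle : ∀ s ∈ Icc (0:ℝ) T, ‖f' s‖ ≤ B' s) :
    ∀ s ∈ Icc (0:ℝ) T, ‖f s‖ ≤ B s := by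
  intro s hs
  refine image_norm_le_of_norm_deriv_right_le_deriv_boundary (f := f) (f' := f') (B := B)
    (B' := B') (a := 0) (b := T) ?_ ?_ ?_ hB ?_ hs
  · intro x hx
    exact ((hf x ⟨hx.1, hx.2.trans hT.2⟩).continuousWithinAt).mono (Icc_subset_Icc_right hT.2)
  · intro x hx
    have hx1 : x < 1 := hx.2.trans_le hT.2
    exact (hf x ⟨hx.1, hx1.le⟩).mono_of_mem_nhdsWithin
      (Icc_mem_nhdsGE_of_mem ⟨hx.1, hx1⟩)
  · simp [h0, hB0]
  · intro x hx
    exact hle x ⟨hx.1, hx.2.le⟩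

/-- **Lemma 8.3.** Let `A : [0,1] → End(ℝ^d)` be `C¹` (a `d × d` matrix-valued function
acting on Euclidean space, so that `‖·‖` is the operator norm) and let `Z` be the
(`d × d` matrix-valued) solution of `Z'' s = A s * Z s` with `Z 0 = 0`, `Z' 0 = I`.
If `‖A s‖ ≤ K` and `‖A' s‖ ≤ K₁` on `[0,1]` with `K, K₁ > 0`, then
`Z s = s • I + (s³/6) • A 0 + s • 𝓔 s` where
`‖𝓔 s‖ ≤ (1/6) (2 K₁ s³ + (1/2) K² s⁴) cosh (√K s)` for all `s ∈ [0,1]`. -/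
theorem taylor_expansion_of_jacobi_solution
    (d : ℕ)
    (A A' : ℝ → (EuclideanSpace ℝ (Fin d) →L[ℝ] EuclideanSpace ℝ (Fin d)))
    (Z Z' Z'' : ℝ → (EuclideanSpace ℝ (Fin d) →L[ℝ] EuclideanSpace ℝ (Fin d)))
    (hA : ∀ s ∈ Icc (0:ℝ) 1, HasDerivWithinAt A (A' s) (Icc 0 1) s)
    (hA' : ContinuousOn A' (Icc 0 1))
    (hZ : ∀ s ∈ Icc (0:ℝ) 1, HasDerivWithinAt Z (Z' s) (Icc 0 1) s)
    (hZ' : ∀ s ∈ Icc (0:ℝ) 1, HasDerivWithinAt Z' (Z'' s) (Icc 0 1) s)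
    (hZ'' : ContinuousOn Z'' (Icc 0 1))
    (hode : ∀ s ∈ Icc (0:ℝ) 1, Z'' s = (A s).comp (Z s))
    (hZ0 : Z 0 = 0) (hZ'0 : Z' 0 = 1)
    (K K₁ : ℝ) (hKpos : 0 < K) (hK₁pos : 0 < K₁)
    (hK : ∀ s ∈ Icc (0:ℝ) 1, ‖A s‖ ≤ K)
    (hK₁ : ∀ s ∈ Icc (0:ℝ) 1, ‖A' s‖ ≤ K₁) :
    ∃ E : ℝ → (EuclideanSpace ℝ (Fin d) →L[ℝ] EuclideanSpace ℝ (Fin d)),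
      (∀ s ∈ Icc (0:ℝ) 1,
        Z s = s • (1 : EuclideanSpace ℝ (Fin d) →L[ℝ] EuclideanSpace ℝ (Fin d))
          + (s ^ 3 / 6) • A 0 + s • E s) ∧
      (∀ s ∈ Icc (0:ℝ) 1,
        ‖E s‖ ≤ (1 / 6) * (2 * K₁ * s ^ 3 + (1 / 2) * K ^ 2 * s ^ 4)
          * Real.cosh (Real.sqrt K * s)) := by
  set k := Real.sqrt K with hk
  have hk0 : 0 < k := Real.sqrt_pos.2 hKpos
  have hkk : k * k = K := Real.mul_self_sqrt hKpos.le
  have zs : ∀ x : EuclideanSpace ℝ (Fin d) →L[ℝ] EuclideanSpace ℝ (Fin d), (0:ℝ) • x = 0 :=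
    fun x => zero_smul ℝ x
  have sz : ∀ r : ℝ, r • (0 : EuclideanSpace ℝ (Fin d) →L[ℝ] EuclideanSpace ℝ (Fin d)) = 0 :=
    fun r => by ext v i; simp
  have h1n : ‖(1 : EuclideanSpace ℝ (Fin d) →L[ℝ] EuclideanSpace ℝ (Fin d))‖ ≤ 1 :=
    ContinuousLinearMap.norm_id_le
  have hode' : ∀ s ∈ Icc (0:ℝ) 1, ‖Z'' s‖ ≤ K * ‖Z s‖ := by
    intro s hs
    rw [hode s hs]
    exact (ContinuousLinearMap.opNorm_comp_le _ _).trans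
      (mul_le_mul_of_nonneg_right (hK s hs) (norm_nonneg _))
  -- exponential bound for the derivative
  have hexp : ∀ s ∈ Icc (0:ℝ) 1, ‖Z' s‖ ≤ Real.exp (k * s) := by
    intro s hs
    have hd : ∀ x ∈ Icc (0:ℝ) 1, HasDerivWithinAt (fun x => (k • Z x, Z' x))
        (k • Z' x, Z'' x) (Icc 0 1) x := fun x hx =>
      ((hZ x hx).const_smul k).prodMk (hZ' x hx)
    have := norm_le_gronwallBound_of_norm_deriv_right_le (f := fun x => (k • Z x, Z' x))
      (f' := fun x => (k • Z' x, Z'' x)) (δ := 1) (K := k) (ε := 0) (a := 0) (b := 1)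
      (fun x hx => (hd x hx).continuousWithinAt)
      (fun x hx => (hd x ⟨hx.1, hx.2.le⟩).mono_of_mem_nhdsWithin (Icc_mem_nhdsGE_of_mem hx))
      (by simpa [sz, hZ0, hZ'0, Prod.norm_def] using h1n)
      (by
        intro x hx
        have h2 := hode' x ⟨hx.1, hx.2.le⟩
        simp only [Prod.norm_def, norm_smul, Real.norm_of_nonneg hk0.le, add_zero]
        apply max_le
        · exact mul_le_mul_of_nonneg_left (le_max_right _ _) hk0.le
        · refine h2.trans ?_
          rw [← hkk, mul_assoc]
          exact mul_le_mul_of_nonneg_left (le_max_left _ _) hk0.le) s hs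
    rw [gronwallBound_ε0, sub_zero, one_mul] at this
    exact (norm_snd_le _).trans this
  have hA0 : (0:ℝ) ∈ Icc (0:ℝ) 1 := ⟨le_rfl, zero_le_one⟩
  have key : ∀ T ∈ Icc (0:ℝ) 1, ‖Z T - T • (1 : EuclideanSpace ℝ (Fin d) →L[ℝ]
      EuclideanSpace ℝ (Fin d)) - (T ^ 3 / 6) • A 0‖ ≤
      K₁ * T ^ 4 / 12 + K ^ 2 * Real.cosh (k * T) * T ^ 5 / 60 := by
    intro T hT
    set c := Real.cosh (k * T) with hc
    have sub : ∀ s ∈ Icc (0:ℝ) T, s ∈ Icc (0:ℝ) 1 := fun s hs => ⟨hs.1, hs.2.trans hT.2⟩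
    have b1 : ∀ s ∈ Icc (0:ℝ) T, ‖Z' s‖ ≤ 2 * c := by
      intro s hs
      refine (hexp s (sub s hs)).trans ?_
      have e1 : Real.exp (k * s) ≤ Real.exp (k * T) :=
        Real.exp_le_exp.2 (mul_le_mul_of_nonneg_left hs.2 hk0.le)
      rw [hc, Real.cosh_eq]
      have := Real.exp_pos (-(k * T))
      linarith
    have b2 := aux_integrate Z Z' (fun s => 2 * c * s) (fun s => 2 * c) T hT hZ hZ0 (by simp)
      (fun s => by simpa using (hasDerivAt_id s).const_mul (2 * c)) b1
    have b3 := aux_integrate (fun s => Z' s - 1) Z'' (fun s => K * c * s ^ 2)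
      (fun s => K * (2 * c * s)) T hT (fun s hs => (hZ' s hs).sub_const 1) (by simp [zs, hZ'0])
      (by simp)
      (fun s => by
        refine HasDerivAt.congr_deriv ((hasDerivAt_pow 2 s).const_mul (K * c)) ?_
        norm_num <;> ring)
      (fun s hs => (hode' s (sub s hs)).trans (mul_le_mul_of_nonneg_left (b2 s hs) hKpos.le))
    have dlin : ∀ s ∈ Icc (0:ℝ) 1, HasDerivWithinAt (fun s : ℝ => s • (1 : EuclideanSpace ℝ (Fin d)
        →L[ℝ] EuclideanSpace ℝ (Fin d))) 1 (Icc 0 1) s := fun s hs => by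
      simpa using ((hasDerivAt_id s).smul_const (1 : EuclideanSpace ℝ (Fin d)
        →L[ℝ] EuclideanSpace ℝ (Fin d))).hasDerivWithinAt
    have dY : ∀ s ∈ Icc (0:ℝ) 1, HasDerivWithinAt (fun s => Z s - s • (1 : EuclideanSpace ℝ (Fin d)
        →L[ℝ] EuclideanSpace ℝ (Fin d))) (Z' s - 1) (Icc 0 1) s := fun s hs =>
      (hZ s hs).sub (dlin s hs)
    have b4 := aux_integrate _ _ (fun s => K * c * s ^ 3 / 3)
      (fun s => K * c * s ^ 2) T hT dY (by simp [zs, hZ0]) (by simp)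
      (fun s => by
        refine HasDerivAt.congr_deriv (((hasDerivAt_pow 3 s).const_mul (K * c)).div_const 3) ?_
        norm_num <;> ring) b3
    have bA := aux_integrate (fun s => A s - A 0) A' (fun s => K₁ * s) (fun s => K₁) T hT
      (fun s hs => (hA s hs).sub_const _) (by simp) (by simp)
      (fun s => by simpa using (hasDerivAt_id s).const_mul K₁) (fun s hs => hK₁ s (sub s hs))
    have b5 := aux_integrate (fun s => Z' s - 1 - (s ^ 2 / 2) • A 0) (fun s => Z'' s - s • A 0)
      (fun s => K₁ * s ^ 3 / 3 + K ^ 2 * c * s ^ 4 / 12)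
      (fun s => K₁ * s ^ 2 + K ^ 2 * c * s ^ 3 / 3) T hT
      (fun s hs => by
        refine ((hZ' s hs).sub_const 1).sub ?_
        have : HasDerivAt (fun s : ℝ => s ^ 2 / 2) s s := by
          refine HasDerivAt.congr_deriv ((hasDerivAt_pow 2 s).div_const 2) ?_
          norm_num
        exact (this.smul_const (A 0)).hasDerivWithinAt)
      (by simp [zs, hZ'0]) (by simp)
      (fun s => by
        refine HasDerivAt.congr_deriv ((((hasDerivAt_pow 3 s).const_mul K₁).div_const 3).add
          (((hasDerivAt_pow 4 s).const_mul (K ^ 2 * c)).div_const 12)) ?_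
        norm_num <;> ring)
      (by
        intro s hs
        have e : Z'' s - s • A 0 = s • (A s - A 0) + (A s).comp (Z s - s • 1) := by
          rw [hode s (sub s hs)]
          ext v i
          simp
          ring
        show ‖Z'' s - s • A 0‖ ≤ _
        rw [e]
        refine (norm_add_le _ _).trans (add_le_add ?_ ?_)
        · rw [norm_smul, Real.norm_of_nonneg hs.1]
          calc s * ‖A s - A 0‖ ≤ s * (K₁ * s) := mul_le_mul_of_nonneg_left (bA s hs) hs.1
            _ = _ := by ring
        · refine (ContinuousLinearMap.opNorm_comp_le _ _).trans ?_
          calc ‖A s‖ * ‖Z s - s • 1‖ ≤ K * (K * c * s ^ 3 / 3) :=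
                mul_le_mul (hK s (sub s hs)) (b4 s hs) (norm_nonneg _) hKpos.le
            _ = _ := by ring)
    have b6 := aux_integrate (fun s => Z s - s • (1 : EuclideanSpace ℝ (Fin d)
        →L[ℝ] EuclideanSpace ℝ (Fin d)) - (s ^ 3 / 6) • A 0)
      (fun s => Z' s - 1 - (s ^ 2 / 2) • A 0)
      (fun s => K₁ * s ^ 4 / 12 + K ^ 2 * c * s ^ 5 / 60)
      (fun s => K₁ * s ^ 3 / 3 + K ^ 2 * c * s ^ 4 / 12) T hT
      (fun s hs => by
        refine (dY s hs).sub ?_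
        have : HasDerivAt (fun s : ℝ => s ^ 3 / 6) (s ^ 2 / 2) s := by
          refine HasDerivAt.congr_deriv ((hasDerivAt_pow 3 s).div_const 6) ?_
          norm_num <;> ring
        exact (this.smul_const (A 0)).hasDerivWithinAt)
      (by simp [zs, hZ0]) (by simp)
      (fun s => by
        refine HasDerivAt.congr_deriv ((((hasDerivAt_pow 4 s).const_mul K₁).div_const 12).add
          (((hasDerivAt_pow 5 s).const_mul (K ^ 2 * c)).div_const 60)) ?_
        norm_num <;> ring) b5
    exact b6 T ⟨hT.1, le_rfl⟩
  refine ⟨fun s => s⁻¹ • (Z s - s • (1 : EuclideanSpace ℝ (Fin d) →L[ℝ]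
      EuclideanSpace ℝ (Fin d)) - (s ^ 3 / 6) • A 0), ?_, ?_⟩
  · intro s hs
    rcases eq_or_ne s 0 with rfl | h
    · simp [zs, hZ0]
    · rw [smul_inv_smul₀ h]
      abel
  · intro s hs
    rcases eq_or_ne s 0 with rfl | h
    · simp [zs]
    · have hs0 : 0 < s := lt_of_le_of_ne hs.1 h.symm
      have hc1 := Real.one_le_cosh (k * s)
      rw [norm_smul, norm_inv, Real.norm_of_nonneg hs.1, inv_mul_le_iff₀ hs0]
      refine (key s hs).trans ?_
      have p1 : 0 < K₁ * s ^ 4 := by positivity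
      have p2 : 0 ≤ K ^ 2 * Real.cosh (k * s) * s ^ 5 := by positivity
      have p3 : K₁ * s ^ 4 ≤ K₁ * s ^ 4 * Real.cosh (k * s) := le_mul_of_one_le_right p1.le hc1
      nlinarith

end
end

section
/- Let N be a standard Gaussian random vector in ℝ^d, and fix ε > 0 and a ≥ 0. Then there exist t₀ > 0 and a constant C < ∞ (depending on ε, a, d) such that for all 0 < t ≤ T ≤ t₀, E[ 1_{√t·|N| ≥ ε} · exp( a·( t·|N|² + d ) ) ] ≤ C·t·exp( −ε²/(4T) ). -/
open MeasureTheory ProbabilityTheory Real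

noncomputable section

/-- The standard Gaussian measure on Euclidean space `ℝ^d`, given by its density
`(2π)^(-d/2) exp (-|x|²/2)` with respect to Lebesgue measure. -/
def stdGaussian (d : ℕ) : Measure (EuclideanSpace ℝ (Fin d)) :=
  (volume : Measure (EuclideanSpace ℝ (Fin d))).withDensity
    (fun x => ENNReal.ofReal ((2 * π) ^ (-(d : ℝ) / 2) * Real.exp (-‖x‖ ^ 2 / 2)))

lemma integrable_aux (d : ℕ) :
    Integrable (fun x : EuclideanSpace ℝ (Fin d) => Real.exp (-(1/16) * ‖x‖ ^ 2)) := by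
  have h := (GaussianFourier.integrable_cexp_neg_mul_sq_norm_add
    (V := EuclideanSpace ℝ (Fin d)) (b := (1/16 : ℂ)) (by norm_num) 0 0).norm
  refine h.congr (Filter.Eventually.of_forall fun x => ?_)
  simp only [Complex.norm_exp]
  congr 1
  have : (-(1/16 : ℂ) * (‖x‖ : ℂ) ^ 2 + 0 * (inner ℝ (0 : EuclideanSpace ℝ (Fin d)) x : ℝ))
      = ((-(1/16) * ‖x‖ ^ 2 : ℝ) : ℂ) := by
    push_cast; ring
  rw [this, Complex.ofReal_re]

/-- The pointwise bound of the exponents. -/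
lemma pointwise_aux (ε a t T r : ℝ) (hε : 0 < ε) (ha : 0 ≤ a) (ht : 0 < t) (htT : t ≤ T)
    (hT : T ≤ 1 / (16 * (a + 1))) (hr : ε ≤ Real.sqrt t * r) :
    Real.exp (-r ^ 2 / 2) * Real.exp (a * (t * r ^ 2)) ≤
      8 / ε ^ 2 * t * Real.exp (-ε ^ 2 / (4 * T)) * Real.exp (-(1/16) * r ^ 2) := by
  have hsq : ε ^ 2 ≤ t * r ^ 2 := by
    have := pow_le_pow_left₀ hε.le hr 2
    rwa [mul_pow, Real.sq_sqrt ht.le] at this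
  have hat : a * t ≤ 1 / 16 := by
    have h1 : t ≤ 1 / (16 * (a + 1)) := htT.trans hT
    rw [le_div_iff₀ (by positivity)] at h1
    nlinarith
  have hT0 : 0 < T := ht.trans_le htT
  set q := ε ^ 2 / t with hq
  have hqpos : 0 < q := by positivity
  have hqr : q ≤ r ^ 2 := by
    rw [hq, div_le_iff₀ ht]; linarith
  have h1 : Real.exp (-(q / 8)) ≤ 8 / ε ^ 2 * t := by
    have h2 : q / 8 ≤ Real.exp (q / 8) := by linarith [Real.add_one_le_exp (q / 8)]
    have h3 : 8 / ε ^ 2 * t = (q / 8)⁻¹ := by rw [hq]; field_simp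
    rw [Real.exp_neg, h3]
    exact inv_anti₀ (by positivity) h2
  have h4 : Real.exp (-(q / 4)) ≤ Real.exp (-ε ^ 2 / (4 * T)) := by
    apply Real.exp_le_exp.mpr
    have : ε ^ 2 / (4 * T) ≤ ε ^ 2 / (4 * t) := by gcongr
    have h5 : q / 4 = ε ^ 2 / (4 * t) := by rw [hq]; field_simp
    rw [h5, neg_div]; linarith
  calc Real.exp (-r ^ 2 / 2) * Real.exp (a * (t * r ^ 2))
      ≤ Real.exp (-(q / 8)) * Real.exp (-(q / 4)) * Real.exp (-(1/16) * r ^ 2) := by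
        rw [← Real.exp_add, ← Real.exp_add, ← Real.exp_add]
        apply Real.exp_le_exp.mpr
        nlinarith [mul_le_mul_of_nonneg_right hat (sq_nonneg r)]
    _ ≤ _ := by gcongr

/-- **The Gaussian estimate from the proof of Proposition 6.4.** Let `N` be a standard
Gaussian random vector in `ℝ^d` and fix `ε > 0` and `a ≥ 0`.  Then there exist `t₀ > 0` and
`C < ∞` (depending on `ε`, `a`, `d`) such that for all `0 < t ≤ T ≤ t₀`,
`E[1_{√t |N| ≥ ε} exp (a (t |N|² + d))] ≤ C t exp (-ε²/(4T))`. -/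
theorem gaussian_indicator_exp_bound (d : ℕ) (ε a : ℝ) (hε : 0 < ε) (ha : 0 ≤ a) :
    ∃ t₀ > (0 : ℝ), ∃ C : ℝ, ∀ t T : ℝ, 0 < t → t ≤ T → T ≤ t₀ →
      ∫⁻ x in {x : EuclideanSpace ℝ (Fin d) | ε ≤ Real.sqrt t * ‖x‖},
          ENNReal.ofReal (Real.exp (a * (t * ‖x‖ ^ 2 + d))) ∂(stdGaussian d)
        ≤ ENNReal.ofReal (C * t * Real.exp (-ε ^ 2 / (4 * T))) := by
  refine ⟨1 / (16 * (a + 1)), by positivity,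
    (2 * π) ^ (-(d : ℝ) / 2) * Real.exp (a * d) * (8 / ε ^ 2) *
      ∫ x : EuclideanSpace ℝ (Fin d), Real.exp (-(1/16) * ‖x‖ ^ 2), ?_⟩
  intro t T ht htT hT
  have hS : MeasurableSet {x : EuclideanSpace ℝ (Fin d) | ε ≤ Real.sqrt t * ‖x‖} :=
    measurableSet_le measurable_const (by fun_prop)
  set K : ℝ := (2 * π) ^ (-(d : ℝ) / 2) * Real.exp (a * d) * (8 / ε ^ 2) * t *
    Real.exp (-ε ^ 2 / (4 * T)) with hK
  have hK0 : 0 ≤ K := by positivity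
  unfold _root_.stdGaussian
  rw [setLIntegral_withDensity_eq_setLIntegral_mul _ (by fun_prop) (by fun_prop) hS]
  calc _ ≤ ∫⁻ x in {x : EuclideanSpace ℝ (Fin d) | ε ≤ Real.sqrt t * ‖x‖},
        ENNReal.ofReal (K * Real.exp (-(1/16) * ‖x‖ ^ 2)) := by
        refine setLIntegral_mono' hS fun x hx => ?_
        simp only [Pi.mul_apply]
        rw [← ENNReal.ofReal_mul (by positivity)]
        apply ENNReal.ofReal_le_ofReal
        have h := pointwise_aux ε a t T ‖x‖ hε ha ht htT hT hx
        have h2 : 0 ≤ (2 * π) ^ (-(d : ℝ) / 2) * Real.exp (a * d) := by positivity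
        have h3 := mul_le_mul_of_nonneg_left h h2
        rw [mul_add, Real.exp_add, hK]
        linarith
    _ ≤ ∫⁻ x : EuclideanSpace ℝ (Fin d), ENNReal.ofReal (K * Real.exp (-(1/16) * ‖x‖ ^ 2)) :=
        setLIntegral_le_lintegral _ _
    _ = ENNReal.ofReal (∫ x : EuclideanSpace ℝ (Fin d), K * Real.exp (-(1/16) * ‖x‖ ^ 2)) := by
        rw [ofReal_integral_eq_lintegral_ofReal ((integrable_aux d).const_mul K)
          (Filter.Eventually.of_forall fun x => by positivity)]
    _ ≤ _ := by
        rw [integral_const_mul, hK]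
        apply ENNReal.ofReal_le_ofReal
        apply le_of_eq
        ring

end
end
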